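/- Fix purely imaginary parameters τ, τ' ∈ iℝ and set 𝒮 = 2(|τ| + |τ'|) + 1. Then there exists a constant C > 0, depending only on τ and τ', such that for every even integer n ≥ 0 and every λ = i·t with real t satisfying t ≥ 𝒮 and t ≥ 4n, and every smooth π-periodic function φ : ℝ → ℂ, one has |F_{λ,n}(φ)| ≤ C · ‖φ‖_{C³} · t^{−3/2}. -/

import Mathlib

open MeasureTheory Real

/-- `pw r z = r^z = exp(z · ln r)` for a real base `r > 0`. -/
noncomputable def pw (r : ℝ) (z : ℂ) : ℂ := Complex.exp (z * (Real.log r : ℂ))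

/-- The kernel `K_{τ,τ',λ}(x,y,z)` of the model trilinear functional. -/
noncomputable def Kker (τ τ' lam : ℂ) (x y z : ℝ) : ℂ :=
  pw |Real.sin (x - y)| ((-τ - τ' + lam - 1) / 2) *
    pw |Real.sin (x - z)| ((-τ + τ' - lam - 1) / 2) *
    pw |Real.sin (y - z)| ((τ - τ' - lam - 1) / 2)

/-- `l_λ(c) = (1/2π) ∫₀^{2π} K_{τ,τ',λ}(y+c, y, 0) dy`. -/
noncomputable def lker (τ τ' lam : ℂ) (c : ℝ) : ℂ :=
  (1 / (2 * (π : ℂ))) * ∫ y in (0 : ℝ)..(2 * π), Kker τ τ' lam (y + c) y 0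

/-- `F_{λ,n}(φ) = ∫₀^{2π} l_λ(c) e^{inc} φ(c) dc`. -/
noncomputable def Ffun (τ τ' lam : ℂ) (n : ℤ) (φ : ℝ → ℂ) : ℂ :=
  ∫ c in (0 : ℝ)..(2 * π),
    lker τ τ' lam c * Complex.exp (Complex.I * (n : ℂ) * (c : ℂ)) * φ c

/-- `k_λ(c) = |sin c|^{(-τ-τ'-1)/2} |sin(c/2)|^{-λ/2} |cos(c/2)|^{λ/2}`. -/
noncomputable def kfun (τ τ' lam : ℂ) (c : ℝ) : ℂ :=
  pw |Real.sin c| ((-τ - τ' - 1) / 2) * pw |Real.sin (c / 2)| (-lam / 2) *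
    pw |Real.cos (c / 2)| (lam / 2)

/-- `G_{λ,n}(φ) = 2 ∫₀^π k_λ(c) e^{inc} φ(c) dc`. -/
noncomputable def Gfun (τ τ' lam : ℂ) (n : ℤ) (φ : ℝ → ℂ) : ℂ :=
  2 * ∫ c in (0 : ℝ)..π,
    kfun τ τ' lam c * Complex.exp (Complex.I * (n : ℂ) * (c : ℂ)) * φ c

/-- Global `C^N`-norm of `φ`. -/
noncomputable def Cnorm (N : ℕ) (φ : ℝ → ℂ) : ℝ :=
  ⨆ (m : Fin (N + 1)) (x : ℝ), ‖iteratedDeriv (m : ℕ) φ x‖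

/-- `f` has `N` derivatives, all of which, like `f` itself, are continuous and bounded by `K`. -/
def SymbolBound : ℕ → ℝ → (ℝ → ℂ) → Prop
  | 0, K, f => Continuous f ∧ ∀ s, ‖f s‖ ≤ K
  | N + 1, K, f => (∀ s, ‖f s‖ ≤ K) ∧ ∃ f', (∀ s, HasDerivAt f (f' s) s) ∧ SymbolBound N K f'

namespace SymbolBound

lemma norm_le {N : ℕ} {K : ℝ} {f : ℝ → ℂ} (h : SymbolBound N K f) (s : ℝ) : ‖f s‖ ≤ K := by
  cases N with
  | zero => exact h.2 s
  | succ N => exact h.1 s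

lemma nonneg {N : ℕ} {K : ℝ} {f : ℝ → ℂ} (h : SymbolBound N K f) : 0 ≤ K :=
  (norm_nonneg _).trans (h.norm_le 0)

lemma continuous {N : ℕ} {K : ℝ} {f : ℝ → ℂ} (h : SymbolBound N K f) : Continuous f := by
  cases N with
  | zero => exact h.1
  | succ N =>
    obtain ⟨-, f', hf', -⟩ := h
    exact continuous_iff_continuousAt.2 fun s => (hf' s).continuousAt

lemma mono {N : ℕ} {K L : ℝ} {f : ℝ → ℂ} (h : SymbolBound N K f) (hKL : K ≤ L) :
    SymbolBound N L f := by
  induction N generalizing f with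
  | zero => exact ⟨h.1, fun s => (h.2 s).trans hKL⟩
  | succ N ih =>
    obtain ⟨hb, f', hf', h'⟩ := h
    exact ⟨fun s => (hb s).trans hKL, f', hf', ih h'⟩

lemma of_succ {N : ℕ} {K : ℝ} {f : ℝ → ℂ} (h : SymbolBound (N + 1) K f) : SymbolBound N K f := by
  induction N generalizing f with
  | zero => exact ⟨h.continuous, h.norm_le⟩
  | succ N ih =>
    obtain ⟨hb, f', hf', h'⟩ := h
    exact ⟨hb, f', hf', ih h'⟩

lemma add {N : ℕ} {K L : ℝ} {f g : ℝ → ℂ} (hf : SymbolBound N K f) (hg : SymbolBound N L g) :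
    SymbolBound N (K + L) (fun s => f s + g s) := by
  induction N generalizing f g with
  | zero =>
    exact ⟨hf.1.add hg.1, fun s => (norm_add_le _ _).trans (add_le_add (hf.2 s) (hg.2 s))⟩
  | succ N ih =>
    obtain ⟨hbf, f', hf', Hf⟩ := hf
    obtain ⟨hbg, g', hg', Hg⟩ := hg
    exact ⟨fun s => (norm_add_le _ _).trans (add_le_add (hbf s) (hbg s)), fun s => f' s + g' s,
      fun s => (hf' s).add (hg' s), ih Hf Hg⟩

lemma mul {N : ℕ} {K L : ℝ} {f g : ℝ → ℂ} (hf : SymbolBound N K f) (hg : SymbolBound N L g) :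
    SymbolBound N (2 ^ N * (K * L)) (fun s => f s * g s) := by
  induction N generalizing f g with
  | zero =>
    refine ⟨hf.1.mul hg.1, fun s => ?_⟩
    rw [norm_mul, pow_zero, one_mul]
    exact mul_le_mul (hf.2 s) (hg.2 s) (norm_nonneg _) hf.nonneg
  | succ N ih =>
    have hK := hf.nonneg
    have hL := hg.nonneg
    have hf0 := hf.of_succ
    have hg0 := hg.of_succ
    obtain ⟨hbf, f', hf', Hf⟩ := hf
    obtain ⟨hbg, g', hg', Hg⟩ := hg
    refine ⟨fun s => ?_, fun s => f' s * g s + f s * g' s, fun s => (hf' s).mul (hg' s), ?_⟩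
    · rw [norm_mul]
      have h1 : ‖f s‖ * ‖g s‖ ≤ K * L := mul_le_mul (hbf s) (hbg s) (norm_nonneg _) hK
      have h2 : (1 : ℝ) ≤ 2 ^ (N + 1) := one_le_pow₀ one_le_two
      nlinarith [mul_nonneg hK hL]
    · refine ((ih Hf hg0).add (ih hf0 Hg)).mono (le_of_eq ?_)
      ring

lemma const (N : ℕ) (z : ℂ) : SymbolBound N ‖z‖ (fun _ => z) := by
  induction N generalizing z with
  | zero => exact ⟨continuous_const, fun _ => le_rfl⟩
  | succ N ih =>
    refine ⟨fun _ => le_rfl, fun _ => 0, fun s => hasDerivAt_const s z, (ih 0).mono ?_⟩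
    simp

lemma const_mul {N : ℕ} {K : ℝ} {f : ℝ → ℂ} (z : ℂ) (hf : SymbolBound N K f) :
    SymbolBound N (‖z‖ * K) (fun s => z * f s) := by
  induction N generalizing f with
  | zero =>
    refine ⟨continuous_const.mul hf.1, fun s => ?_⟩
    rw [norm_mul]
    exact mul_le_mul_of_nonneg_left (hf.2 s) (norm_nonneg _)
  | succ N ih =>
    obtain ⟨hbf, f', hf', Hf⟩ := hf
    refine ⟨fun s => ?_, fun s => z * f' s, fun s => (hf' s).const_mul z, ih Hf⟩
    rw [norm_mul]
    exact mul_le_mul_of_nonneg_left (hbf s) (norm_nonneg _)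

lemma exists_twisted_deriv {N : ℕ} {K L : ℝ} {f m : ℝ → ℂ} (hf : SymbolBound (N + 1) K f)
    (hm : SymbolBound N L m) :
    ∃ g, (∀ s, HasDerivAt f (g s - m s * f s) s) ∧ SymbolBound N ((2 ^ N * L + 1) * K) g := by
  have hf0 := hf.of_succ
  obtain ⟨-, f', hf', Hf⟩ := hf
  refine ⟨fun s => m s * f s + f' s, fun s => ?_, ((hm.mul hf0).add Hf).mono (le_of_eq ?_)⟩
  · simpa using hf' s
  · ring

end SymbolBound

/-- Two integrations by parts against an oscillating weight `W` with `W' = (iP + m) W`. -/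
lemma norm_integral_mul_le_of_nonstationary {t K L M : ℝ} (ht : 0 < t) {W P m σ ψ : ℝ → ℂ}
    (hW : ∀ s, HasDerivAt W ((Complex.I * P s + m s) * W s) s) (hWi : Integrable W)
    (hσP : ∀ s, σ s * P s = t) (hσ : SymbolBound 2 K σ) (hm : SymbolBound 1 L m)
    (hψ : SymbolBound 2 M ψ) :
    ‖∫ s, W s * ψ s‖ ≤
      ((L + 1) * (2 * K * ((2 * L + 1) * (4 * (K * M))))) / t ^ 2 * ∫ s, ‖W s‖ := by
  obtain ⟨f₁, hf₁, Hf₁⟩ := (hσ.mul hψ).exists_twisted_deriv hm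
  obtain ⟨f₂, hf₂, Hf₂⟩ := (hσ.of_succ.mul Hf₁).exists_twisted_deriv hm.of_succ
  have htc : (t : ℂ) ≠ 0 := by exact_mod_cast ht.ne'
  set X := ((L + 1) * (2 * K * ((2 * L + 1) * (4 * (K * M))))) with hX
  have hb₂ : ∀ s, ‖f₂ s‖ ≤ X := fun s => (Hf₂.norm_le s).trans (le_of_eq (by rw [hX]; ring))
  have hmulint : ∀ {N : ℕ} {R : ℝ} {g : ℝ → ℂ}, SymbolBound N R g →
      Integrable fun s => W s * g s := fun {N R g} hg =>
    hWi.mul_bdd (c := R) hg.continuous.aestronglyMeasurable (Filter.Eventually.of_forall hg.norm_le)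
  have hder : ∀ s, HasDerivAt
      (fun s => W s * (-Complex.I / t * (σ s * ψ s) + 1 / (t : ℂ) ^ 2 * (σ s * f₁ s)))
      (W s * ψ s + 1 / (t : ℂ) ^ 2 * (W s * f₂ s)) s := by
    intro s
    convert! (hW s).mul (((hf₁ s).const_mul (-Complex.I / (t : ℂ))).add
      ((hf₂ s).const_mul (1 / (t : ℂ) ^ 2))) using 1
    have h1 : P s * (σ s * ψ s) = t * ψ s := by rw [← hσP s]; ring
    have h2 : P s * (σ s * f₁ s) = t * f₁ s := by rw [← hσP s]; ring
    simp only [Pi.add_apply]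
    have e : (Complex.I * P s + m s) * W s *
          (-Complex.I / t * (σ s * ψ s) + 1 / (t : ℂ) ^ 2 * (σ s * f₁ s)) =
        W s * (-(Complex.I * Complex.I) / t * (P s * (σ s * ψ s))
          + Complex.I / (t : ℂ) ^ 2 * (P s * (σ s * f₁ s))
          + m s * (-Complex.I / t * (σ s * ψ s) + 1 / (t : ℂ) ^ 2 * (σ s * f₁ s))) := by ring
    rw [e, h1, h2, Complex.I_mul_I]
    field_simp
    ring
  have hI0 := integral_eq_zero_of_hasDerivAt_of_integrable hder
    ((hmulint hψ).add ((hmulint Hf₂).const_mul _))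
    (hmulint (((hσ.mul hψ).of_succ.const_mul _).add ((hσ.of_succ.mul Hf₁).const_mul _)))
  rw [integral_add (hmulint hψ) ((hmulint Hf₂).const_mul _), integral_const_mul] at hI0
  rw [eq_neg_of_add_eq_zero_left hI0, norm_neg, norm_mul]
  have hn : ‖1 / (t : ℂ) ^ 2‖ = 1 / t ^ 2 := by
    simp [abs_of_pos ht]
  rw [hn, div_mul_eq_mul_div, div_mul_eq_mul_div, one_mul]
  gcongr
  rw [← integral_const_mul]
  refine norm_integral_le_of_norm_le (hWi.norm.const_mul _) (Filter.Eventually.of_forall fun s => ?_)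
  rw [norm_mul, mul_comm]
  exact mul_le_mul_of_nonneg_right (hb₂ s) (norm_nonneg _)

/-- The derivative in `s` of `arctan (a e^s)`. -/
noncomputable def kSym (a s : ℝ) : ℝ := exp s * a / (1 + (exp s * a) ^ 2)

/-- The logarithmic derivative of `kSym a`. -/
noncomputable def ellSym (a s : ℝ) : ℝ := (1 - (exp s * a) ^ 2) / (1 + (exp s * a) ^ 2)

/-- The angle `arctan u - arctan v` along the ray `(u, v) = (a e^s, b e^s)`. -/
noncomputable def angle (a b s : ℝ) : ℝ := arctan (exp s * a) - arctan (exp s * b)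

lemma abs_kSym_le (a s : ℝ) : |kSym a s| ≤ 1 / 2 := by
  unfold kSym
  have h : 0 < 1 + (exp s * a) ^ 2 := by positivity
  rw [abs_div, abs_of_pos h, div_le_iff₀ h, abs_le]
  constructor <;> nlinarith [sq_nonneg (exp s * a - 1), sq_nonneg (exp s * a + 1)]

lemma abs_ellSym_le (a s : ℝ) : |ellSym a s| ≤ 1 := by
  unfold ellSym
  have h : 0 < 1 + (exp s * a) ^ 2 := by positivity
  rw [abs_div, abs_of_pos h, div_le_iff₀ h, abs_le]
  constructor <;> nlinarith [sq_nonneg (exp s * a)]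

lemma hasDerivAt_kSym (a s : ℝ) : HasDerivAt (kSym a) (kSym a s * ellSym a s) s := by
  have h : 1 + (exp s * a) ^ 2 ≠ 0 := by positivity
  have h1 : HasDerivAt (fun s => exp s * a) (exp s * a) s := (hasDerivAt_exp s).mul_const a
  convert! h1.div ((h1.pow 2).const_add 1) h using 1
  simp only [kSym, ellSym, Pi.pow_apply]
  field_simp
  simp only [Nat.cast_ofNat]
  ring

lemma hasDerivAt_ellSym (a s : ℝ) : HasDerivAt (ellSym a) (-4 * (kSym a s * kSym a s)) s := by
  have h : 1 + (exp s * a) ^ 2 ≠ 0 := by positivity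
  have h1 : HasDerivAt (fun s => exp s * a) (exp s * a) s := (hasDerivAt_exp s).mul_const a
  convert! ((h1.pow 2).const_sub 1).div ((h1.pow 2).const_add 1) h using 1
  simp only [kSym, Pi.pow_apply]
  field_simp
  simp only [Nat.cast_ofNat]
  ring

lemma hasDerivAt_angle (a b s : ℝ) : HasDerivAt (angle a b) (kSym a s - kSym b s) s := by
  have h1 : ∀ a, HasDerivAt (fun s => exp s * a) (exp s * a) s := fun a =>
    (hasDerivAt_exp s).mul_const a
  convert! (h1 a).arctan.sub (h1 b).arctan using 1
  simp only [kSym]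
  ring

lemma hasDerivAt_log_one_add_sq (a s : ℝ) :
    HasDerivAt (fun s => log (1 + (exp s * a) ^ 2)) (1 - ellSym a s) s := by
  have h : 1 + (exp s * a) ^ 2 ≠ 0 := by positivity
  have h1 : HasDerivAt (fun s => exp s * a) (exp s * a) s := (hasDerivAt_exp s).mul_const a
  convert! ((h1.pow 2).const_add 1).log h using 1
  simp only [ellSym, Pi.pow_apply]
  field_simp
  simp only [Nat.cast_ofNat]
  ring

lemma continuous_kSym (a : ℝ) : Continuous (kSym a) :=
  continuous_iff_continuousAt.2 fun s => (hasDerivAt_kSym a s).continuousAt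

lemma continuous_ellSym (a : ℝ) : Continuous (ellSym a) :=
  continuous_iff_continuousAt.2 fun s => (hasDerivAt_ellSym a s).continuousAt

lemma continuous_angle (a b : ℝ) : Continuous (angle a b) :=
  continuous_iff_continuousAt.2 fun s => (hasDerivAt_angle a b s).continuousAt

lemma exists_symbolBound_kSym_ellSym (N : ℕ) :
    ∃ K, ∀ a, SymbolBound N K (fun s => (kSym a s : ℂ)) ∧
      SymbolBound N K (fun s => (ellSym a s : ℂ)) := by
  have hk : ∀ a s, ‖(kSym a s : ℂ)‖ ≤ 1 := fun a s => by
    rw [Complex.norm_real, norm_eq_abs]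
    exact (abs_kSym_le a s).trans (by norm_num)
  have hl : ∀ a s, ‖(ellSym a s : ℂ)‖ ≤ 1 := fun a s => by
    rw [Complex.norm_real, norm_eq_abs]
    exact abs_ellSym_le a s
  induction N with
  | zero =>
    exact ⟨1, fun a => ⟨⟨Complex.continuous_ofReal.comp (continuous_kSym a), hk a⟩,
      ⟨Complex.continuous_ofReal.comp (continuous_ellSym a), hl a⟩⟩⟩
  | succ N ih =>
    obtain ⟨K, hK⟩ := ih
    refine ⟨1 + 2 ^ N * (K * K) + ‖(-4 : ℂ)‖ * (2 ^ N * (K * K)), fun a => ?_⟩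
    have hK' := (hK 0).1.nonneg
    have hK0 : 0 ≤ 2 ^ N * (K * K) := by positivity
    have hK1 : 0 ≤ ‖(-4 : ℂ)‖ * (2 ^ N * (K * K)) := by positivity
    refine ⟨⟨fun s => (hk a s).trans (by linarith), _, fun s => (hasDerivAt_kSym a s).ofReal_comp, ?_⟩,
      ⟨fun s => (hl a s).trans (by linarith), _, fun s => (hasDerivAt_ellSym a s).ofReal_comp, ?_⟩⟩
    · push_cast
      exact ((hK a).1.mul (hK a).2).mono (by linarith)
    · push_cast
      exact (((hK a).1.mul (hK a).1).const_mul (-4)).mono (by linarith)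

lemma exists_symbolBound_angleDeriv (N : ℕ) :
    ∃ K, ∀ a b, SymbolBound N K (fun s => ((kSym a s - kSym b s : ℝ) : ℂ)) := by
  obtain ⟨K, hK⟩ := exists_symbolBound_kSym_ellSym N
  refine ⟨K + ‖(-1 : ℂ)‖ * K, fun a b => ?_⟩
  convert! (hK a).1.add ((hK b).1.const_mul (-1)) using 2
  push_cast
  ring

lemma abs_kSym_sub_le (a b s : ℝ) : |kSym a s - kSym b s| ≤ 1 := by
  have h1 := abs_le.1 (abs_kSym_le a s)
  have h2 := abs_le.1 (abs_kSym_le b s)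
  rw [abs_le]
  constructor <;> linarith [h1.1, h1.2, h2.1, h2.2]

lemma quarter_le_half_add {ν : ℝ} (h0 : 0 ≤ ν) (h1 : ν ≤ 1 / 4) (a b s : ℝ) :
    1 / 4 ≤ 1 / 2 + ν * (kSym a s - kSym b s) := by
  have h := abs_le.1 (abs_kSym_sub_le a b s)
  nlinarith [h.1, h.2]

lemma exists_symbolBound_inv_phaseDeriv (N : ℕ) :
    ∃ K, ∀ a b ν : ℝ, 0 ≤ ν → ν ≤ 1 / 4 →
      SymbolBound N K (fun s => (((1 / 2 + ν * (kSym a s - kSym b s))⁻¹ : ℝ) : ℂ)) := by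
  have hb : ∀ a b ν : ℝ, 0 ≤ ν → ν ≤ 1 / 4 → ∀ s,
      ‖(((1 / 2 + ν * (kSym a s - kSym b s))⁻¹ : ℝ) : ℂ)‖ ≤ 4 := fun a b ν h0 h1 s => by
    have h := quarter_le_half_add h0 h1 a b s
    rw [Complex.norm_real, norm_eq_abs, abs_of_nonneg (inv_nonneg.2 (by linarith))]
    exact (inv_anti₀ (by norm_num) h).trans (by norm_num)
  induction N with
  | zero =>
    refine ⟨4, fun a b ν h0 h1 => ⟨Complex.continuous_ofReal.comp (Continuous.inv₀ ?_ fun s => ?_),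
      hb a b ν h0 h1⟩⟩
    · exact continuous_const.add
        (continuous_const.mul ((continuous_kSym a).sub (continuous_kSym b)))
    · have h := quarter_le_half_add h0 h1 a b s
      positivity
  | succ N ih =>
    obtain ⟨K, hK⟩ := ih
    obtain ⟨L, hL⟩ := exists_symbolBound_kSym_ellSym N
    have hK0 : 0 ≤ K := (hK 0 0 0 le_rfl (by norm_num)).nonneg
    have hL0 : 0 ≤ L := (hL 0).1.nonneg
    refine ⟨4 + 2 ^ N * ((2 ^ N * (L * L) + ‖(-1 : ℂ)‖ * (2 ^ N * (L * L))) * (2 ^ N * (K * K))),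
      fun a b ν h0 h1 => ⟨fun s => (hb a b ν h0 h1 s).trans ?_, _, fun s => HasDerivAt.ofReal_comp
        ((((hasDerivAt_kSym a s).sub (hasDerivAt_kSym b s)).const_mul ν).const_add (1 / 2)
          |>.inv (ne_of_gt (lt_of_lt_of_le (by norm_num) (quarter_le_half_add h0 h1 a b s)))), ?_⟩⟩
    · have : 0 ≤ 2 ^ N * ((2 ^ N * (L * L) + ‖(-1 : ℂ)‖ * (2 ^ N * (L * L))) * (2 ^ N * (K * K))) := by
        positivity
      linarith
    · have h := ((((hL a).1.mul (hL a).2).add (((hL b).1.mul (hL b).2).const_mul (-1))).mul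
        ((hK a b ν h0 h1).mul (hK a b ν h0 h1))).const_mul (-(ν : ℂ))
      convert! h.mono _ using 2 with s
      · simp only [Pi.sub_apply]
        push_cast
        rw [div_eq_mul_inv, sq, mul_inv]
        ring
      · rw [norm_neg, Complex.norm_real, norm_eq_abs, abs_of_nonneg h0]
        have : 0 ≤ 2 ^ N * ((2 ^ N * (L * L) + ‖(-1 : ℂ)‖ * (2 ^ N * (L * L))) *
          (2 ^ N * (K * K))) := by positivity
        nlinarith

lemma exists_symbolBound_comp_angle (N : ℕ) :
    ∃ K, 0 ≤ K ∧ ∀ (a b M : ℝ) (φ : ℝ → ℂ), ContDiff ℝ (⊤ : ℕ∞) φ →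
      (∀ j ≤ N, ∀ x, ‖iteratedDeriv j φ x‖ ≤ M) →
      SymbolBound N (K * M) (fun s => φ (angle a b s)) := by
  induction N with
  | zero =>
    refine ⟨1, zero_le_one, fun a b M φ hφ hM =>
      ⟨hφ.continuous.comp (continuous_angle a b), fun s => ?_⟩⟩
    simpa using hM 0 le_rfl (angle a b s)
  | succ N ih =>
    obtain ⟨K, hK0, hK⟩ := ih
    obtain ⟨L, hL⟩ := exists_symbolBound_angleDeriv N
    have hL0 : 0 ≤ L := (hL 0 0).nonneg
    refine ⟨1 + 2 ^ N * (K * L), by positivity, fun a b M φ hφ hM => ?_⟩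
    have hM0 : 0 ≤ M := (norm_nonneg _).trans (hM 0 (Nat.zero_le _) 0)
    have hd : ContDiff ℝ (⊤ : ℕ∞) (deriv φ) := (contDiff_infty_iff_deriv.1 hφ).2
    have H := hK a b M (deriv φ) hd fun j hj x => by
      rw [← iteratedDeriv_succ']
      exact hM (j + 1) (by omega) x
    refine ⟨fun s => ?_, _, fun s => HasDerivAt.scomp s
      (((contDiff_infty_iff_deriv.1 hφ).1 (angle a b s)).hasDerivAt) (hasDerivAt_angle a b s), ?_⟩
    · have h := hM 0 (Nat.zero_le _) (angle a b s)
      rw [iteratedDeriv_zero] at h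
      refine h.trans ?_
      have : 0 ≤ 2 ^ N * (K * L) * M := by positivity
      linarith
    · convert! (H.mul (hL a b)).mono _ using 2 with s
      · rw [Complex.real_smul, mul_comm]
      · nlinarith

/-- The kernel times the Jacobian along the ray `(u, v) = (a e^s, b e^s)`. -/
noncomputable def rayWeight (τ τ' : ℂ) (n : ℤ) (t a b s : ℝ) : ℂ :=
  Complex.exp ((-τ - τ' + Complex.I * t - 1) / 2 * log |a - b| +
    ((-τ - τ' + Complex.I * t + 3) / 2) * s +
    (τ - 1) / 2 * (log (1 + (exp s * a) ^ 2) : ℝ) +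
    (τ' - 1) / 2 * (log (1 + (exp s * b) ^ 2) : ℝ) + Complex.I * n * (angle a b s : ℝ))

lemma hasDerivAt_rayWeight (τ τ' : ℂ) (n : ℤ) (t a b s : ℝ) :
    HasDerivAt (rayWeight τ τ' n t a b)
      ((Complex.I * ((t / 2 + n * (kSym a s - kSym b s) : ℝ) : ℂ) +
        (1 / 2 + (-((τ - 1) / 2) * (ellSym a s : ℂ) + -((τ' - 1) / 2) * (ellSym b s : ℂ)))) *
        rayWeight τ τ' n t a b s) s := by
  have h1 : HasDerivAt (fun s : ℝ => (s : ℂ)) 1 s := by simpa using (hasDerivAt_id s).ofReal_comp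
  convert! (((((h1.const_mul ((-τ - τ' + Complex.I * t + 3) / 2)).const_add
    ((-τ - τ' + Complex.I * t - 1) / 2 * log |a - b|)).add
    ((hasDerivAt_log_one_add_sq a s).ofReal_comp.const_mul ((τ - 1) / 2))).add
    ((hasDerivAt_log_one_add_sq b s).ofReal_comp.const_mul ((τ' - 1) / 2))).add
    ((hasDerivAt_angle a b s).ofReal_comp.const_mul (Complex.I * n))).cexp using 1
  rw [mul_comm]
  congr 1
  push_cast
  ring

lemma exists_norm_integral_rayWeight_le (τ τ' : ℂ) :
    ∃ C, 0 ≤ C ∧ ∀ (n : ℤ) (t a b M : ℝ) (φ : ℝ → ℂ), 0 ≤ n → 0 < t → 4 * (n : ℝ) ≤ t →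
      ContDiff ℝ (⊤ : ℕ∞) φ → (∀ j ≤ 2, ∀ x, ‖iteratedDeriv j φ x‖ ≤ M) →
      Integrable (rayWeight τ τ' n t a b) →
      ‖∫ s, rayWeight τ τ' n t a b s * φ (angle a b s)‖ ≤
        C * M / t ^ 2 * ∫ s, ‖rayWeight τ τ' n t a b s‖ := by
  obtain ⟨K, hK⟩ := exists_symbolBound_inv_phaseDeriv 2
  obtain ⟨K', hK'0, hK'⟩ := exists_symbolBound_comp_angle 2
  obtain ⟨L, hL⟩ := exists_symbolBound_kSym_ellSym 1
  have hK0 : 0 ≤ K := (hK 0 0 0 le_rfl (by norm_num)).nonneg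
  have hL0 : 0 ≤ L := (hL 0).1.nonneg
  set R := ‖(1 / 2 : ℂ)‖ + (‖-((τ - 1) / 2)‖ * L + ‖-((τ' - 1) / 2)‖ * L) with hR
  have hR0 : 0 ≤ R := by positivity
  refine ⟨(R + 1) * (2 * K * ((2 * R + 1) * (4 * (K * K')))), by positivity, ?_⟩
  intro n t a b M φ hn ht hnt hφ hM hW
  have hn' : (0 : ℝ) ≤ n := by exact_mod_cast hn
  have hν : (n : ℝ) / t ≤ 1 / 4 := by
    rw [div_le_iff₀ ht]
    linarith
  refine (norm_integral_mul_le_of_nonstationary ht (hasDerivAt_rayWeight τ τ' n t a b) hW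
    (fun s => ?_) (hK a b (n / t) (by positivity) hν)
    ((SymbolBound.const 1 (1 / 2)).add
      (((hL a).2.const_mul (-((τ - 1) / 2))).add ((hL b).2.const_mul (-((τ' - 1) / 2)))))
    (hK' a b M φ hφ hM)).trans (le_of_eq ?_)
  · have h := quarter_le_half_add (by positivity) hν a b s
    rw [← Complex.ofReal_mul, Complex.ofReal_inj, inv_mul_eq_iff_eq_mul₀ (by positivity)]
    field_simp
  · rw [← hR]
    ring

lemma norm_rayWeight {τ τ' : ℂ} (hτ : τ.re = 0) (hτ' : τ'.re = 0) (n : ℤ) (t a b s : ℝ) :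
    ‖rayWeight τ τ' n t a b s‖ = ‖rayWeight 0 0 0 0 a b s‖ := by
  unfold rayWeight
  rw [Complex.norm_exp, Complex.norm_exp]
  congr 1
  simp [hτ, hτ']

/-- The model singularity `|sin s|^{-3/4}`. -/
noncomputable def sinWeight (s : ℝ) : ℝ := exp (-(3 / 4) * log |sin s|)

lemma measurable_sinWeight : Measurable sinWeight := by
  unfold sinWeight
  fun_prop

lemma intervalIntegrable_sinWeight (a b : ℝ) : IntervalIntegrable sinWeight volume a b := by
  have hper : Function.Periodic sinWeight π := fun s => by
    simp [sinWeight, sin_add_pi]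
  have heven : ∀ s, sinWeight s = sinWeight (-s) := fun s => by simp [sinWeight]
  have hpos : ∀ x, 0 < x → x ≤ π / 2 → IntervalIntegrable sinWeight volume 0 x := by
    intro x hx hx2
    have h1 : IntervalIntegrable (fun s : ℝ => (2 / π) ^ (-(3 / 4) : ℝ) * s ^ (-(3 / 4) : ℝ))
        volume 0 x :=
      (intervalIntegral.intervalIntegrable_rpow' (by norm_num)).const_mul _
    refine h1.mono_fun' measurable_sinWeight.aestronglyMeasurable ?_
    rw [Set.uIoc_of_le hx.le]
    filter_upwards [ae_restrict_mem measurableSet_Ioc] with s hs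
    have hs0 : 0 < 2 / π * s := by have := hs.1; positivity
    have hle := mul_le_sin hs.1.le (hs.2.trans hx2)
    rw [sinWeight, norm_of_nonneg (exp_pos _).le, abs_of_pos (hs0.trans_le hle),
      ← mul_rpow (by positivity) hs.1.le, rpow_def_of_pos hs0, mul_comm (log _)]
    exact exp_le_exp.2 (mul_le_mul_of_nonpos_left (log_le_log hs0 hle) (by norm_num))
  have h2 : IntervalIntegrable sinWeight volume 0 (π / 2) := hpos _ (by positivity) le_rfl
  have h3 : IntervalIntegrable sinWeight volume (-(π / 2)) 0 := by
    rw [IntervalIntegrable.iff_comp_neg]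
    simp_rw [← heven]
    simpa using h2.symm
  refine hper.intervalIntegrable pi_pos.ne' (t := -(π / 2)) ?_ a b
  convert! h3.trans h2 using 1
  ring

lemma exp_neg_half_le (a b c : ℝ) :
    exp (-(1 / 2) * a + -(1 / 2) * b + -(1 / 2) * c) ≤
      exp (-(3 / 4) * a) * exp (-(3 / 4) * b) + exp (-(3 / 4) * a) * exp (-(3 / 4) * c) +
        exp (-(3 / 4) * b) * exp (-(3 / 4) * c) := by
  simp only [← exp_add]
  have h1 := exp_pos (-(3 / 4) * a + -(3 / 4) * b)
  have h2 := exp_pos (-(3 / 4) * a + -(3 / 4) * c)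
  have h3 := exp_pos (-(3 / 4) * b + -(3 / 4) * c)
  by_cases hab : -(1 / 2) * a + -(1 / 2) * b + -(1 / 2) * c ≤ -(3 / 4) * a + -(3 / 4) * b
  · linarith [exp_le_exp.2 hab]
  by_cases hac : -(1 / 2) * a + -(1 / 2) * b + -(1 / 2) * c ≤ -(3 / 4) * a + -(3 / 4) * c
  · linarith [exp_le_exp.2 hac]
  · linarith [exp_le_exp.2 (show -(1 / 2) * a + -(1 / 2) * b + -(1 / 2) * c ≤
      -(3 / 4) * b + -(3 / 4) * c by linarith)]

lemma integrableOn_box_of_norm_le {f : ℝ × ℝ → ℂ} (hf : Measurable f) {M : ℝ}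
    (hM : ∀ c y, ‖f (c, y)‖ ≤ M * exp (-(1 / 2) * log |sin c| + -(1 / 2) * log |sin (y + c)| +
      -(1 / 2) * log |sin y|)) (R : ℝ) :
    IntegrableOn f (Set.Ioo (-R) R ×ˢ Set.Ioo (-R) R) := by
  set g : ℝ → ℝ := (Set.Ioo (-(2 * R)) (2 * R)).indicator sinWeight with hg
  have hgi : Integrable g := by
    rw [hg, integrable_indicator_iff measurableSet_Ioo]
    by_cases hR : 0 ≤ R
    · exact ((intervalIntegrable_iff_integrableOn_Ioo_of_le (by linarith)).1
        (intervalIntegrable_sinWeight _ _))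
    · rw [Set.Ioo_eq_empty (by linarith)]
      exact integrableOn_empty
  have hg2 : Integrable (fun z : ℝ × ℝ => g z.1 * g z.2) (volume.prod volume) := hgi.mul_prod hgi
  have hA : Integrable (fun z : ℝ × ℝ => g z.1 * g (z.1 + z.2)) (volume.prod volume) :=
    (measurePreserving_prod_add volume volume).integrable_comp_of_integrable hg2
  have hB : Integrable (fun z : ℝ × ℝ => g (z.1 + z.2) * g z.2) (volume.prod volume) :=
    (measurePreserving_add_prod volume volume).integrable_comp_of_integrable hg2
  have hM0 : 0 ≤ M := by
    have h := (norm_nonneg _).trans (hM 0 0)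
    exact nonneg_of_mul_nonneg_left h (exp_pos _)
  rw [← Measure.volume_eq_prod] at hg2 hA hB
  refine Integrable.mono' (((hA.add hg2).add hB).const_mul M).integrableOn
    hf.aestronglyMeasurable ?_
  filter_upwards [ae_restrict_mem (measurableSet_Ioo.prod measurableSet_Ioo)] with z hz
  obtain ⟨⟨h1, h2⟩, h3, h4⟩ := hz
  refine (hM z.1 z.2).trans (mul_le_mul_of_nonneg_left ?_ hM0)
  refine (exp_neg_half_le _ _ _).trans (le_of_eq ?_)
  have e1 : g z.1 = sinWeight z.1 :=
    Set.indicator_of_mem (Set.mem_Ioo.2 ⟨by linarith, by linarith⟩) _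
  have e2 : g z.2 = sinWeight z.2 :=
    Set.indicator_of_mem (Set.mem_Ioo.2 ⟨by linarith, by linarith⟩) _
  have e3 : g (z.1 + z.2) = sinWeight (z.1 + z.2) :=
    Set.indicator_of_mem (Set.mem_Ioo.2 ⟨by linarith, by linarith⟩) _
  simp only [Pi.add_apply, e1, e2, e3, sinWeight, add_comm z.2 z.1]

lemma lintegral_Ioo_zero_pi (h : ℝ → ENNReal) :
    ∫⁻ x in Set.Ioo 0 π, h x =
      ∫⁻ u, ENNReal.ofReal (1 / (1 + u ^ 2)) * h (π / 2 + arctan u) := by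
  have himg : (fun u => π / 2 + arctan u) '' Set.univ = Set.Ioo 0 π := by
    have h1 : (fun u => π / 2 + arctan u) = (fun x => π / 2 + x) ∘ arctan := rfl
    rw [h1, Set.image_comp, Set.image_univ, range_arctan, Set.image_const_add_Ioo]
    congr 1 <;> ring
  rw [← himg, lintegral_image_eq_lintegral_abs_deriv_mul MeasurableSet.univ
    (fun u _ => ((hasDerivAt_arctan u).const_add (π / 2)).hasDerivWithinAt)
    (fun u _ v _ huv => arctan_injective (add_left_cancel huv)), Measure.restrict_univ]
  refine lintegral_congr fun u => ?_
  rw [abs_of_pos (by positivity)]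

lemma lintegral_Ioi_zero (h : ℝ → ENNReal) :
    ∫⁻ r in Set.Ioi 0, h r = ∫⁻ s, ENNReal.ofReal (exp s) * h (exp s) := by
  rw [← range_exp, ← Set.image_univ, lintegral_image_eq_lintegral_abs_deriv_mul MeasurableSet.univ
    (fun u _ => (hasDerivAt_exp u).hasDerivWithinAt) (exp_injective.injOn), Measure.restrict_univ]
  simp_rw [abs_exp]

/-- Logarithmic polar coordinates for the cotangents, up to sign, of a pair of angles. -/
noncomputable def rayMap (p : ℝ × ℝ) : ℝ × ℝ :=
  (π / 2 + arctan (exp p.2 * cos p.1), π / 2 + arctan (exp p.2 * sin p.1))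

/-- The Jacobian of `rayMap`. -/
noncomputable def rayJac (p : ℝ × ℝ) : ℝ :=
  exp p.2 * (exp p.2 * (1 / (1 + (exp p.2 * cos p.1) ^ 2) * (1 / (1 + (exp p.2 * sin p.1) ^ 2))))

lemma measurable_rayMap : Measurable rayMap := by
  unfold rayMap
  fun_prop

lemma measurable_rayJac : Measurable rayJac := by
  unfold rayJac
  fun_prop

lemma rayJac_pos (p : ℝ × ℝ) : 0 < rayJac p := by
  unfold rayJac
  positivity

/-- The strip `(-π, π) × ℝ` of parameters of `rayMap`. -/
noncomputable def rayMeasure : Measure (ℝ × ℝ) :=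
  (volume.restrict (Set.Ioo (-π) π)).prod volume

lemma lintegral_square_eq {h : ℝ × ℝ → ENNReal} (hh : Measurable h) :
    ∫⁻ p in Set.Ioo 0 π ×ˢ Set.Ioo 0 π, h p =
      ∫⁻ p, ENNReal.ofReal (rayJac p) * h (rayMap p) ∂rayMeasure := by
  set H : ℝ × ℝ → ENNReal := fun p => ENNReal.ofReal (1 / (1 + p.1 ^ 2)) *
    (ENNReal.ofReal (1 / (1 + p.2 ^ 2)) * h (π / 2 + arctan p.1, π / 2 + arctan p.2)) with hH
  have hHm : Measurable H := by fun_prop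
  have e1 : ∫⁻ p in Set.Ioo 0 π ×ˢ Set.Ioo 0 π, h p = ∫⁻ p, H p := by
    rw [Measure.volume_eq_prod, ← Measure.prod_restrict, lintegral_prod _ hh.aemeasurable,
      lintegral_Ioo_zero_pi, lintegral_prod _ hHm.aemeasurable]
    refine lintegral_congr fun u => ?_
    rw [lintegral_Ioo_zero_pi, hH]
    exact (lintegral_const_mul _ (by fun_prop)).symm
  rw [e1, ← lintegral_comp_polarCoord_symm, polarCoord_target, Measure.volume_eq_prod,
    ← Measure.prod_restrict, lintegral_prod_symm', rayMeasure, lintegral_prod]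
  · refine lintegral_congr fun θ => ?_
    rw [lintegral_Ioi_zero]
    refine lintegral_congr fun s => ?_
    simp only [hH, polarCoord_symm_apply, smul_eq_mul, rayMap, rayJac]
    rw [ENNReal.ofReal_mul (by positivity), ENNReal.ofReal_mul (by positivity),
      ENNReal.ofReal_mul (by positivity)]
    ring
  · exact ((measurable_rayJac.ennreal_ofReal).mul (hh.comp measurable_rayMap)).aemeasurable
  · exact (measurable_fst.ennreal_ofReal).smul (hHm.comp continuous_polarCoord_symm.measurable)

lemma map_rayMap :
    (rayMeasure.withDensity fun p => ENNReal.ofReal (rayJac p)).map rayMap =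
      volume.restrict (Set.Ioo 0 π ×ˢ Set.Ioo 0 π) := by
  ext s hs
  rw [Measure.map_apply measurable_rayMap hs, withDensity_apply _ (measurable_rayMap hs),
    ← lintegral_indicator_one hs, lintegral_square_eq (measurable_one.indicator hs),
    ← lintegral_indicator (measurable_rayMap hs)]
  refine lintegral_congr fun p => ?_
  by_cases hp : rayMap p ∈ s
  · rw [Set.indicator_of_mem (show p ∈ rayMap ⁻¹' s from hp), Set.indicator_of_mem hp]
    simp
  · rw [Set.indicator_of_notMem (show p ∉ rayMap ⁻¹' s from hp), Set.indicator_of_notMem hp]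
    simp

lemma integrable_rayJac_smul {f : ℝ × ℝ → ℂ} (hf : Measurable f)
    (hi : IntegrableOn f (Set.Ioo 0 π ×ˢ Set.Ioo 0 π)) :
    Integrable (fun p => rayJac p • f (rayMap p)) rayMeasure := by
  rw [IntegrableOn, ← map_rayMap, integrable_map_measure hf.aestronglyMeasurable
    measurable_rayMap.aemeasurable, integrable_withDensity_iff_integrable_smul'
    measurable_rayJac.ennreal_ofReal (by simp)] at hi
  simpa only [ENNReal.toReal_ofReal (rayJac_pos _).le, Function.comp_apply] using hi

lemma setIntegral_square_eq {f : ℝ × ℝ → ℂ} (hf : Measurable f) :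
    ∫ p in Set.Ioo 0 π ×ˢ Set.Ioo 0 π, f p = ∫ p, rayJac p • f (rayMap p) ∂rayMeasure := by
  rw [← map_rayMap, integral_map measurable_rayMap.aemeasurable hf.aestronglyMeasurable,
    integral_withDensity_eq_integral_toReal_smul measurable_rayJac.ennreal_ofReal (by simp)]
  simp only [ENNReal.toReal_ofReal (rayJac_pos _).le]

/-- The integrand of `Ffun` on the square torus, with the third point at `0`. -/
noncomputable def torusKer (τ τ' : ℂ) (n : ℤ) (t : ℝ) (φ : ℝ → ℂ) (p : ℝ × ℝ) : ℂ :=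
  Kker τ τ' (Complex.I * t) p.1 p.2 0 * Complex.exp (Complex.I * n * (p.1 - p.2 : ℝ)) *
    φ (p.1 - p.2)

lemma measurable_torusKer (τ τ' : ℂ) (n : ℤ) (t : ℝ) {φ : ℝ → ℂ} (hφ : Continuous φ) :
    Measurable (torusKer τ τ' n t φ) := by
  have := hφ.measurable
  unfold torusKer Kker pw
  fun_prop

lemma norm_torusKer_le {τ τ' : ℂ} (hτ : τ.re = 0) (hτ' : τ'.re = 0) (n : ℤ) (t : ℝ) {φ : ℝ → ℂ}
    {M : ℝ} (hM : ∀ x, ‖φ x‖ ≤ M) (c y : ℝ) :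
    ‖torusKer τ τ' n t φ (y + c, y)‖ ≤
      M * exp (-(1 / 2) * log |sin c| + -(1 / 2) * log |sin (y + c)| +
        -(1 / 2) * log |sin y|) := by
  rw [torusKer, norm_mul, mul_comm]
  refine mul_le_mul (hM _) (le_of_eq ?_) (norm_nonneg _) ((norm_nonneg _).trans (hM 0))
  rw [Kker, pw, pw, pw, ← Complex.exp_add, ← Complex.exp_add, ← Complex.exp_add, Complex.norm_exp]
  congr 1
  simp [hτ, hτ']
  ring

lemma integrableOn_box_torusKer {τ τ' : ℂ} (hτ : τ.re = 0) (hτ' : τ'.re = 0) (n : ℤ) (t : ℝ)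
    {φ : ℝ → ℂ} (hφ : Continuous φ) {M : ℝ} (hM : ∀ x, ‖φ x‖ ≤ M) (R : ℝ) :
    IntegrableOn (fun p : ℝ × ℝ => torusKer τ τ' n t φ (p.2 + p.1, p.2))
      (Set.Ioo (-R) R ×ˢ Set.Ioo (-R) R) := by
  have hm : Measurable (fun p : ℝ × ℝ => torusKer τ τ' n t φ (p.2 + p.1, p.2)) :=
    (measurable_torusKer τ τ' n t hφ).comp
      (by fun_prop : Measurable fun p : ℝ × ℝ => ((p.2 + p.1, p.2) : ℝ × ℝ))
  exact integrableOn_box_of_norm_le (M := M) hm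
    (fun c y => norm_torusKer_le hτ hτ' n t hM c y) R

lemma integrableOn_square_torusKer {τ τ' : ℂ} (hτ : τ.re = 0) (hτ' : τ'.re = 0) (n : ℤ) (t : ℝ)
    {φ : ℝ → ℂ} (hφ : Continuous φ) {M : ℝ} (hM : ∀ x, ‖φ x‖ ≤ M) :
    IntegrableOn (torusKer τ τ' n t φ) (Set.Ioo 0 π ×ˢ Set.Ioo 0 π) := by
  have h := (integrableOn_box_torusKer hτ hτ' n t hφ hM π).integrable_indicator
    (measurableSet_Ioo.prod measurableSet_Ioo)
  rw [Measure.volume_eq_prod] at h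
  have h2 := (measurePreserving_sub_prod (volume : Measure ℝ)
    (volume : Measure ℝ)).integrable_comp_of_integrable h
  rw [← Measure.volume_eq_prod] at h2
  refine h2.integrableOn.congr_fun (fun p hp => ?_) (measurableSet_Ioo.prod measurableSet_Ioo)
  obtain ⟨⟨h1, h2⟩, h3, h4⟩ := hp
  rw [Function.comp_apply, Set.indicator_of_mem]
  · simp
  · exact Set.mem_prod.2 ⟨Set.mem_Ioo.2 ⟨by dsimp only; linarith, by dsimp only; linarith⟩,
      Set.mem_Ioo.2 ⟨by dsimp only; linarith, h4⟩⟩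

lemma torusKer_add_pi_fst (τ τ' : ℂ) {n : ℤ} (hn : Even n) (t : ℝ) {φ : ℝ → ℂ}
    (hφ : Function.Periodic φ π) (x y : ℝ) :
    torusKer τ τ' n t φ (x + π, y) = torusKer τ τ' n t φ (x, y) := by
  obtain ⟨m, rfl⟩ := hn
  have e : Complex.exp (Complex.I * ((m + m : ℤ) : ℂ) * ((x + π - y : ℝ) : ℂ)) =
      Complex.exp (Complex.I * ((m + m : ℤ) : ℂ) * ((x - y : ℝ) : ℂ)) := by
    rw [Complex.exp_eq_exp_iff_exists_int]
    exact ⟨m, by push_cast; ring⟩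
  simp only [torusKer, Kker, e]
  rw [show x + π - y = x - y + π by ring, show x + π - 0 = x - 0 + π by ring, sin_add_pi,
    sin_add_pi, abs_neg, abs_neg, hφ]

lemma torusKer_add_pi_snd (τ τ' : ℂ) {n : ℤ} (hn : Even n) (t : ℝ) {φ : ℝ → ℂ}
    (hφ : Function.Periodic φ π) (x y : ℝ) :
    torusKer τ τ' n t φ (x, y + π) = torusKer τ τ' n t φ (x, y) := by
  obtain ⟨m, rfl⟩ := hn
  have e : Complex.exp (Complex.I * ((m + m : ℤ) : ℂ) * ((x - (y + π) : ℝ) : ℂ)) =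
      Complex.exp (Complex.I * ((m + m : ℤ) : ℂ) * ((x - y : ℝ) : ℂ)) := by
    rw [Complex.exp_eq_exp_iff_exists_int]
    exact ⟨-m, by push_cast; ring⟩
  simp only [torusKer, Kker, e]
  rw [show x - (y + π) = x - y - π by ring, show y + π - 0 = y - 0 + π by ring, sin_sub_pi,
    sin_add_pi, abs_neg, abs_neg, hφ.sub_eq]

lemma integral_zero_two_pi_of_periodic {f : ℝ → ℂ} (hf : Function.Periodic f π) :
    ∫ x in 0..2 * π, f x = 2 * ∫ x in 0..π, f x := by
  have h2 : ∫ x in π..2 * π, f x = ∫ x in 0..π, f x := by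
    have h := hf.intervalIntegral_add_eq π 0
    rwa [zero_add, ← two_mul] at h
  by_cases hi : IntervalIntegrable f volume 0 π
  · have hall := hf.intervalIntegrable pi_pos.ne' (t := 0) (by rwa [zero_add])
    rw [← intervalIntegral.integral_add_adjacent_intervals (hall 0 π) (hall π (2 * π)), h2, two_mul]
  · rw [intervalIntegral.integral_undef hi, intervalIntegral.integral_undef, mul_zero]
    intro h
    refine hi (h.mono_set ?_)
    rw [Set.uIcc_of_le pi_pos.le, Set.uIcc_of_le (by positivity)]
    exact Set.Icc_subset_Icc le_rfl (by linarith [pi_pos])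

lemma Ffun_eq {τ τ' : ℂ} (hτ : τ.re = 0) (hτ' : τ'.re = 0) {n : ℤ} (hn : Even n) (t : ℝ)
    {φ : ℝ → ℂ} (hφ : Continuous φ) (hper : Function.Periodic φ π) {M : ℝ}
    (hM : ∀ x, ‖φ x‖ ≤ M) :
    Ffun τ τ' (Complex.I * t) n φ =
      2 / π * ∫ p in Set.Ioo 0 π ×ˢ Set.Ioo 0 π, torusKer τ τ' n t φ p := by
  have hpi := pi_pos
  have e1 : ∀ c, lker τ τ' (Complex.I * t) c * Complex.exp (Complex.I * n * c) * φ c =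
      1 / (2 * (π : ℂ)) * ∫ y in 0..2 * π, torusKer τ τ' n t φ (y + c, y) := by
    intro c
    simp only [torusKer, add_sub_cancel_left]
    rw [intervalIntegral.integral_mul_const, intervalIntegral.integral_mul_const, lker]
    ring
  have e2 : ∀ y, ∫ c in 0..2 * π, torusKer τ τ' n t φ (y + c, y) =
      2 * ∫ x in 0..π, torusKer τ τ' n t φ (x, y) := by
    intro y
    have hp : Function.Periodic (fun x => torusKer τ τ' n t φ (x, y)) π := fun x =>
      torusKer_add_pi_fst τ τ' hn t hper x y
    have hp2 : Function.Periodic (fun x => torusKer τ τ' n t φ (x, y)) (2 * π) := by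
      simpa using hp.nat_mul 2
    have h := hp2.intervalIntegral_add_eq y 0
    rw [zero_add, integral_zero_two_pi_of_periodic hp] at h
    rw [← h, intervalIntegral.integral_comp_add_left (fun x => torusKer τ τ' n t φ (x, y)),
      add_zero]
  have e3 : ∫ y in 0..2 * π, ∫ x in 0..π, torusKer τ τ' n t φ (x, y) =
      2 * ∫ y in 0..π, ∫ x in 0..π, torusKer τ τ' n t φ (x, y) :=
    integral_zero_two_pi_of_periodic fun y => by
      simp only [torusKer_add_pi_snd τ τ' hn t hper]
  have hswap : ∫ c in 0..2 * π, ∫ y in 0..2 * π, torusKer τ τ' n t φ (y + c, y) =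
      ∫ y in 0..2 * π, ∫ c in 0..2 * π, torusKer τ τ' n t φ (y + c, y) := by
    simp only [intervalIntegral.integral_of_le (show (0 : ℝ) ≤ 2 * π by positivity)]
    refine integral_integral_swap ?_
    rw [Measure.prod_restrict, ← Measure.volume_eq_prod]
    refine (integrableOn_box_torusKer hτ hτ' n t hφ hM (4 * π)).mono_set ?_
    exact Set.prod_mono (fun x hx => ⟨by linarith [hx.1], by linarith [hx.2]⟩)
      (fun x hx => ⟨by linarith [hx.1], by linarith [hx.2]⟩)
  have hsq : ∫ p in Set.Ioo 0 π ×ˢ Set.Ioo 0 π, torusKer τ τ' n t φ p =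
      ∫ y in 0..π, ∫ x in 0..π, torusKer τ τ' n t φ (x, y) := by
    have h := integrableOn_square_torusKer hτ hτ' n t hφ hM
    rw [IntegrableOn, Measure.volume_eq_prod, ← Measure.prod_restrict] at h
    simp only [intervalIntegral.integral_of_le hpi.le, integral_Ioc_eq_integral_Ioo]
    rw [Measure.volume_eq_prod, ← Measure.prod_restrict, integral_prod_symm _ h]
  have hpc : (π : ℂ) ≠ 0 := by exact_mod_cast hpi.ne'
  simp only [Ffun, e1]
  rw [intervalIntegral.integral_const_mul, hswap]
  simp only [e2]
  rw [intervalIntegral.integral_const_mul, e3, hsq]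
  field_simp

lemma log_abs_sin_half_pi_add_arctan (u : ℝ) :
    log |sin (π / 2 + arctan u)| = -(1 / 2) * log (1 + u ^ 2) := by
  rw [add_comm, sin_add_pi_div_two, cos_arctan, log_abs, one_div, log_inv, log_sqrt (by positivity)]
  ring

lemma log_abs_sin_arctan_sub {u v : ℝ} (huv : u ≠ v) :
    log |sin (arctan u - arctan v)| =
      log |u - v| - 1 / 2 * log (1 + u ^ 2) - 1 / 2 * log (1 + v ^ 2) := by
  have h1 : (0 : ℝ) < 1 + u ^ 2 := by positivity
  have h2 : (0 : ℝ) < 1 + v ^ 2 := by positivity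
  have e : sin (arctan u - arctan v) = (u - v) / (√(1 + u ^ 2) * √(1 + v ^ 2)) := by
    rw [sin_sub, sin_arctan, cos_arctan, sin_arctan, cos_arctan]
    field_simp
  rw [e, log_abs, log_abs, log_div (sub_ne_zero.2 huv) (by positivity),
    log_mul (by positivity) (by positivity), log_sqrt h1.le, log_sqrt h2.le]
  ring

lemma rayJac_smul_torusKer (τ τ' : ℂ) (n : ℤ) (t : ℝ) (φ : ℝ → ℂ) {θ : ℝ} (hθ : cos θ ≠ sin θ)
    (s : ℝ) :
    rayJac (θ, s) • torusKer τ τ' n t φ (rayMap (θ, s)) =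
      rayWeight τ τ' n t (cos θ) (sin θ) s * φ (angle (cos θ) (sin θ) s) := by
  have hne : exp s * cos θ ≠ exp s * sin θ := fun h => hθ (mul_left_cancel₀ (exp_pos s).ne' h)
  have hsub : π / 2 + arctan (exp s * cos θ) - (π / 2 + arctan (exp s * sin θ)) =
      arctan (exp s * cos θ) - arctan (exp s * sin θ) := by ring
  have hlog : log |exp s * cos θ - exp s * sin θ| = s + log |cos θ - sin θ| := by
    rw [← mul_sub, abs_mul, abs_exp, log_mul (exp_pos s).ne'
      (abs_ne_zero.2 (sub_ne_zero.2 hθ)), log_exp]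
  have hjac : rayJac (θ, s) = exp (2 * s - log (1 + (exp s * cos θ) ^ 2) -
      log (1 + (exp s * sin θ) ^ 2)) := by
    rw [exp_sub, exp_sub, exp_log (by positivity), exp_log (by positivity), two_mul, exp_add,
      rayJac]
    field_simp
  rw [Complex.real_smul, hjac, Complex.ofReal_exp]
  simp only [torusKer, Kker, pw, rayMap, hsub, sub_zero, log_abs_sin_half_pi_add_arctan,
    log_abs_sin_arctan_sub hne, hlog]
  rw [rayWeight, angle, ← Complex.exp_add, ← Complex.exp_add, ← Complex.exp_add, ← mul_assoc,
    ← Complex.exp_add]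
  congr 2
  push_cast
  ring

lemma ae_cos_ne_sin : ∀ᵐ θ : ℝ, cos θ ≠ sin θ := by
  refine Set.Countable.ae_notMem (s := {θ : ℝ | cos θ = sin θ}) ?_ volume
  refine (Set.countable_range fun k : ℤ => (k : ℝ) * π + π / 4).mono fun θ hθ => ?_
  have h : sin (θ - π / 4) = 0 := by
    rw [sin_sub, cos_pi_div_four, sin_pi_div_four, show cos θ = sin θ from hθ, sub_self]
  obtain ⟨k, hk⟩ := sin_eq_zero_iff.1 h
  exact ⟨k, by dsimp only; linarith⟩

lemma ae_rayMeasure_cos_ne_sin : ∀ᵐ p ∂rayMeasure, cos p.1 ≠ sin p.1 :=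
  Measure.quasiMeasurePreserving_fst.ae (ae_restrict_of_ae ae_cos_ne_sin)

lemma integrable_rayWeight {τ τ' : ℂ} (hτ : τ.re = 0) (hτ' : τ'.re = 0) (n : ℤ) (t : ℝ) :
    Integrable (fun p : ℝ × ℝ => rayWeight τ τ' n t (cos p.1) (sin p.1) p.2) rayMeasure := by
  have hc : Continuous fun _ : ℝ => (1 : ℂ) := continuous_const
  refine (integrable_rayJac_smul (measurable_torusKer τ τ' n t hc)
    (integrableOn_square_torusKer hτ hτ' n t hc (M := 1) (by simp))).congr ?_
  filter_upwards [ae_rayMeasure_cos_ne_sin] with p hp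
  rw [rayJac_smul_torusKer τ τ' n t _ hp p.2, mul_one]

lemma exists_norm_setIntegral_torusKer_le {τ τ' : ℂ} (hτ : τ.re = 0) (hτ' : τ'.re = 0) :
    ∃ C, 0 ≤ C ∧ ∀ (n : ℤ) (t M : ℝ) (φ : ℝ → ℂ), 0 ≤ n → 0 < t → 4 * (n : ℝ) ≤ t →
      ContDiff ℝ (⊤ : ℕ∞) φ → (∀ j ≤ 2, ∀ x, ‖iteratedDeriv j φ x‖ ≤ M) →
      ‖∫ p in Set.Ioo 0 π ×ˢ Set.Ioo 0 π, torusKer τ τ' n t φ p‖ ≤ C * M / t ^ 2 := by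
  obtain ⟨C, hC0, hC⟩ := exists_norm_integral_rayWeight_le τ τ'
  refine ⟨C * ∫ p, ‖rayWeight 0 0 0 0 (cos p.1) (sin p.1) p.2‖ ∂rayMeasure,
    mul_nonneg hC0 (integral_nonneg fun _ => norm_nonneg _), ?_⟩
  intro n t M φ hn ht hnt hφ hM
  have hM0 : ∀ x, ‖φ x‖ ≤ M := fun x => by simpa using hM 0 (by norm_num) x
  have hmeas := measurable_torusKer τ τ' n t hφ.continuous
  have hi := integrable_rayJac_smul hmeas
    (integrableOn_square_torusKer hτ hτ' n t hφ.continuous hM0)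
  have hwi := integrable_rayWeight hτ hτ' n t
  have hn0 : ∫ p, ‖rayWeight 0 0 0 0 (cos p.1) (sin p.1) p.2‖ ∂rayMeasure =
      ∫ p, ‖rayWeight τ τ' n t (cos p.1) (sin p.1) p.2‖ ∂rayMeasure := by
    simp only [norm_rayWeight hτ hτ' n t]
  rw [setIntegral_square_eq hmeas, hn0]
  unfold rayMeasure at hi hwi ⊢
  rw [integral_prod _ hi, integral_prod _ hwi.norm]
  refine (norm_integral_le_of_norm_le (hwi.norm.integral_prod_left.const_mul (C * M / t ^ 2))
    ?_).trans (le_of_eq ?_)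
  · filter_upwards [ae_restrict_of_ae ae_cos_ne_sin, hwi.prod_right_ae] with θ hθ hθi
    simp only [rayJac_smul_torusKer τ τ' n t φ hθ]
    exact hC n t _ _ M φ hn ht hnt hφ hM hθi
  · rw [integral_const_mul]
    ring

lemma norm_iteratedDeriv_le_Cnorm {φ : ℝ → ℂ} (hφ : ContDiff ℝ (⊤ : ℕ∞) φ)
    (hper : Function.Periodic φ π) {N j : ℕ} (hj : j ≤ N) (x : ℝ) :
    ‖iteratedDeriv j φ x‖ ≤ Cnorm N φ := by
  have hb : ∀ j : ℕ, BddAbove (Set.range fun x => ‖iteratedDeriv j φ x‖) := by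
    intro j
    have hp : Function.Periodic (iteratedDeriv j φ) π := fun x => by
      have h := congrFun (iteratedDeriv_comp_add_const j φ π) x
      rw [show (fun x => φ (x + π)) = φ from funext hper] at h
      exact h.symm
    have hc : Continuous (iteratedDeriv j φ) := hφ.continuous_iteratedDeriv j (by exact_mod_cast le_top)
    obtain ⟨R, hR⟩ := (hp.isBounded_of_continuous pi_pos.ne' hc).exists_norm_le
    exact ⟨R, by rintro _ ⟨x, rfl⟩; exact hR _ ⟨x, rfl⟩⟩
  refine (le_ciSup (hb j) x).trans ?_
  exact le_ciSup (f := fun m : Fin (N + 1) => ⨆ x, ‖iteratedDeriv (m : ℕ) φ x‖)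
    (Set.finite_range _).bddAbove ⟨j, by omega⟩

/-- For `t ≥ 𝒮 = 2(|τ|+|τ'|)+1` and `t ≥ 4n`: `|F_{it,n}(φ)| ≤ C ‖φ‖_{C³} t^{-3/2}`. -/
theorem stmt_9 (τ τ' : ℂ) (hτ : τ.re = 0) (hτ' : τ'.re = 0) :
    ∃ C : ℝ, 0 < C ∧
      ∀ n : ℤ, 0 ≤ n → Even n →
        ∀ t : ℝ, 2 * (‖τ‖ + ‖τ'‖) + 1 ≤ t → 4 * (n : ℝ) ≤ t →
          ∀ φ : ℝ → ℂ, ContDiff ℝ (⊤ : ℕ∞) φ → (∀ x : ℝ, φ (x + π) = φ x) →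
            ‖Ffun τ τ' (Complex.I * (t : ℂ)) n φ‖ ≤ C * Cnorm 3 φ * t ^ (-(3 / 2) : ℝ) := by
  obtain ⟨C, hC0, hC⟩ := exists_norm_setIntegral_torusKer_le hτ hτ'
  refine ⟨2 / π * C + 1, by positivity, fun n hn0 hn t ht hnt φ hφ hper => ?_⟩
  have ht1 : 1 ≤ t := by linarith [norm_nonneg τ, norm_nonneg τ']
  have ht0 : 0 < t := one_pos.trans_le ht1
  have hM : ∀ j ≤ 2, ∀ x, ‖iteratedDeriv j φ x‖ ≤ Cnorm 3 φ := fun j hj x =>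
    norm_iteratedDeriv_le_Cnorm hφ hper (by omega) x
  have hM0 : ∀ x, ‖φ x‖ ≤ Cnorm 3 φ := fun x => by simpa using hM 0 (by norm_num) x
  have hMn : 0 ≤ Cnorm 3 φ := (norm_nonneg _).trans (hM0 0)
  have hpow : 1 / t ^ 2 ≤ t ^ (-(3 / 2) : ℝ) := by
    rw [one_div, ← rpow_natCast, ← rpow_neg ht0.le]
    exact rpow_le_rpow_of_exponent_le ht1 (by norm_num)
  rw [Ffun_eq hτ hτ' hn t hφ.continuous hper hM0, norm_mul]
  have hpi : ‖(2 / π : ℂ)‖ = 2 / π := by simp [abs_of_pos pi_pos]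
  rw [hpi]
  calc 2 / π * ‖∫ p in Set.Ioo 0 π ×ˢ Set.Ioo 0 π, torusKer τ τ' n t φ p‖
      ≤ 2 / π * (C * Cnorm 3 φ / t ^ 2) := by
        gcongr
        exact hC n t _ φ hn0 ht0 hnt hφ hM
    _ = 2 / π * C * Cnorm 3 φ * (1 / t ^ 2) := by ring
    _ ≤ (2 / π * C + 1) * Cnorm 3 φ * t ^ (-(3 / 2) : ℝ) := by
        gcongr
        linarith
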